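/- If Δ : A → A ⊗_ℂ A is a unital ℂ-algebra homomorphism satisfying Δ(M_α^β) = Σ_γ M_α^γ ⊗ M_γ^β and Δ(M̄_α̇^β̇) = Σ_γ M̄_α̇^γ̇ ⊗ M̄_γ̇^β̇, then the Lorentz generators are comultiplicative: Δ(Λ_L^K) = Σ_I Λ_L^I ⊗ Λ_I^K for all L, K ∈ {0,1,2,3}. -/

import Mathlib

noncomputable section

open scoped Matrix

/-- Lower undotted spinor metric `ε_{αβ}` of the two-parameter deformation. -/
def epsLo (q r : ℝ) : Matrix (Fin 2) (Fin 2) ℂ :=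
  ((Real.sqrt (1 - r ^ 2) : ℂ))⁻¹ •
    !![Complex.I * (r : ℂ), -((Real.sqrt q : ℂ))⁻¹; (Real.sqrt q : ℂ), Complex.I * (r : ℂ)]

/-- Upper undotted spinor metric `ε^{αβ}`. -/
def epsUp (q r : ℝ) : Matrix (Fin 2) (Fin 2) ℂ :=
  ((Real.sqrt (1 - r ^ 2) : ℂ))⁻¹ •
    !![Complex.I * (r : ℂ), ((Real.sqrt q : ℂ))⁻¹; -(Real.sqrt q : ℂ), Complex.I * (r : ℂ)]

/-- Lower dotted spinor metric `ε_{α̇β̇}`. -/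
def epsLoD (q r : ℝ) : Matrix (Fin 2) (Fin 2) ℂ :=
  ((Real.sqrt (1 - r ^ 2) : ℂ))⁻¹ •
    !![-(Complex.I * (r : ℂ)), (Real.sqrt q : ℂ); -((Real.sqrt q : ℂ))⁻¹, -(Complex.I * (r : ℂ))]

/-- Upper dotted spinor metric `ε^{α̇β̇}`. -/
def epsUpD (q r : ℝ) : Matrix (Fin 2) (Fin 2) ℂ :=
  ((Real.sqrt (1 - r ^ 2) : ℂ))⁻¹ •
    !![-(Complex.I * (r : ℂ)), -(Real.sqrt q : ℂ); ((Real.sqrt q : ℂ))⁻¹, -(Complex.I * (r : ℂ))]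

/-- `Q = (2r + q + q⁻¹)/(1 − r²)`. -/
def Qval (q r : ℝ) : ℝ := (2 * r + q + q⁻¹) / (1 - r ^ 2)

/-- The R-matrix `R^{αβ}_{γδ} = δ^α_γ δ^β_δ + c · ε^{αβ} ε_{γδ}` (with `c = a^{±1}`). -/
def Rm (q r : ℝ) (c : ℂ) (α β γ δ : Fin 2) : ℂ :=
  (if α = γ then 1 else 0) * (if β = δ then 1 else 0) + c * epsUp q r α β * epsLo q r γ δ

/-- The conjugate `σ̄_±^{α̇β} = a^{±1/2} Σ ε^{α̇λ̇} ε_{ρκ} R^{∓σκ}_{μν} ε^{μλ} ε^{νβ} σ_{σρ̇}`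
of a 2×2 matrix `σ`; `s = true` is the `+` sign, `s = false` the `−` sign. -/
def sbar (q r a : ℝ) (s : Bool) (σ : Matrix (Fin 2) (Fin 2) ℂ) (ad b : Fin 2) : ℂ :=
  (if s then (Real.sqrt a : ℂ) else ((Real.sqrt a : ℂ))⁻¹) *
    ∑ l, ∑ sg, ∑ rh, ∑ ka, ∑ mu, ∑ nu,
      epsUpD q r ad l * epsLo q r rh ka * Rm q r (if s then ((a : ℂ))⁻¹ else (a : ℂ)) sg ka mu nu *
        epsUp q r mu l * epsUp q r nu b * σ sg rh

/-- The quantum Pauli matrices `σ^0, σ^1, σ^2, σ^3`. -/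
def pauli : Fin 4 → Matrix (Fin 2) (Fin 2) ℂ :=
  ![!![1, 0; 0, 1], !![0, 1; 1, 0], !![0, -Complex.I; Complex.I, 0], !![1, 0; 0, -1]]

/-- The metric pairing `G_±^{IJ} = (1/Q) Σ ε^{αν} σ^I_{αβ̇} σ̄_±^{Jβ̇γ} ε_{γν}`. -/
def Gpair (q r a : ℝ) (s : Bool) (σI σJ : Matrix (Fin 2) (Fin 2) ℂ) : ℂ :=
  (1 / (Qval q r : ℂ)) * ∑ al, ∑ nu, ∑ be, ∑ ga,
    epsUp q r al nu * σI al be * sbar q r a s σJ be ga * epsLo q r ga nu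

/-- The quantum Minkowski metric `G_±^{IJ}` as a 4×4 matrix. -/
def GupM (q r a : ℝ) (s : Bool) : Matrix (Fin 4) (Fin 4) ℂ :=
  fun I J => Gpair q r a s (pauli I) (pauli J)

/-- The inverse metric `G_{±IJ}`. -/
def GloM (q r a : ℝ) (s : Bool) : Matrix (Fin 4) (Fin 4) ℂ := (GupM q r a s)⁻¹

/-- The lowered conjugate Pauli matrices `σ̄_L^{α̇β} = Σ_N G_{+LN} σ̄_+^{Nα̇β}`. -/
def sbarL (q r a : ℝ) (L : Fin 4) (ad b : Fin 2) : ℂ :=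
  ∑ N, GloM q r a true L N * sbar q r a true (pauli N) ad b

/-- The quantum Lorentz group generators
`Λ_L^K = (1/Q) Σ ε_{γ̇δ̇} σ̄_L^{δ̇α} M_α^σ σ^K_{σρ̇} M̄_β̇^{ρ̇} ε^{γ̇β̇}`. -/
def Lor {A : Type*} [Ring A] [Algebra ℂ A] (q r a : ℝ)
    (M Mb : Fin 2 → Fin 2 → A) (L K : Fin 4) : A :=
  ∑ ga, ∑ de, ∑ al, ∑ sg, ∑ rh, ∑ be,
    ((1 / (Qval q r : ℂ)) * epsLoD q r ga de * sbarL q r a L de al * pauli K sg rh *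
      epsUpD q r ga be) • (M al sg * Mb be rh)

/-- The Lorentz R-matrices
`𝓡^{±NM}_{LK} = (1/Q²) Σ R^{∓ακ}_{τσ} R^{∓μβ}_{κν} R^{±ρξ}_{δα} R^{±λγ}_{ξμ}
σ^{M β̇}_γ σ^{N λ̇}_ρ σ̄_{Lτ̇}^δ σ̄_{Kν̇}^σ`. -/
def Rlor (q r a : ℝ) (s : Bool) (N M L K : Fin 4) : ℂ :=
  (1 / (Qval q r : ℂ) ^ 2) *
    ∑ al, ∑ be, ∑ ga, ∑ de, ∑ ka, ∑ l, ∑ mu, ∑ nu, ∑ xi, ∑ rh, ∑ sg, ∑ ta,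
      Rm q r (if s then ((a : ℂ))⁻¹ else (a : ℂ)) al ka ta sg *
        Rm q r (if s then ((a : ℂ))⁻¹ else (a : ℂ)) mu be ka nu *
          Rm q r (if s then (a : ℂ) else ((a : ℂ))⁻¹) rh xi de al *
            Rm q r (if s then (a : ℂ) else ((a : ℂ))⁻¹) l ga xi mu *
              (∑ p, epsUpD q r be p * pauli M ga p) *
                (∑ p, epsUpD q r l p * pauli N rh p) *
                  (∑ p, epsLoD q r ta p * sbarL q r a L p de) *
                    (∑ p, epsLoD q r nu p * sbarL q r a K p sg)

end

open scoped Matrix in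
theorem epsUpD_eq (q r : ℝ) : epsUpD q r = -(epsLo q r)ᵀ := by
  ext i j
  fin_cases i <;> fin_cases j <;> simp [epsUpD, epsLo]

open scoped Matrix in
theorem epsLoD_eq (q r : ℝ) : epsLoD q r = -(epsUp q r)ᵀ := by
  ext i j
  fin_cases i <;> fin_cases j <;> simp [epsLoD, epsUp]

theorem epsLo_mul_epsUp {q r : ℝ} (hq : 0 < q) (hr : r ^ 2 < 1) :
    epsLo q r * epsUp q r = 1 := by
  have hs : (Real.sqrt q : ℂ) ≠ 0 := by
    exact_mod_cast (Real.sqrt_pos.mpr hq).ne'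
  have ht : (Real.sqrt (1 - r ^ 2) : ℂ) ≠ 0 := by
    exact_mod_cast (Real.sqrt_pos.mpr (sub_pos.mpr hr)).ne'
  have ht2 : (Real.sqrt (1 - r ^ 2) : ℂ) ^ 2 = 1 - (r : ℂ) ^ 2 := by
    exact_mod_cast Real.sq_sqrt (sub_pos.mpr hr).le
  ext i j
  fin_cases i <;> fin_cases j <;>
    simp [epsLo, epsUp, Matrix.mul_apply, Fin.sum_univ_two] <;> field_simp <;>
    simp [Complex.I_sq, ht2] <;> ring

open scoped Matrix in
/-- The conjugate of a `2 × 2` matrix in closed form. -/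
theorem sbar_eq {q r : ℝ} (hq : 0 < q) (hr : r ^ 2 < 1) (a : ℝ) (s : Bool)
    (σ : Matrix (Fin 2) (Fin 2) ℂ) :
    sbar q r a s σ = -(if s then (Real.sqrt a : ℂ) else ((Real.sqrt a : ℂ))⁻¹) •
      (σ + ((if s then ((a : ℂ))⁻¹ else (a : ℂ)) *
        (σ * (epsLo q r * (epsUp q r)ᵀ)).trace) • (1 : Matrix (Fin 2) (Fin 2) ℂ)) := by
  ext i j
  have h1 := epsLo_mul_epsUp hq hr
  have h2 := mul_eq_one_comm.mp h1
  have hR : ∀ c : ℂ, ∑ l, ∑ sg, ∑ rh, ∑ ka, ∑ mu, ∑ nu,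
      epsUpD q r i l * epsLo q r rh ka * Rm q r c sg ka mu nu *
        epsUp q r mu l * epsUp q r nu j * σ sg rh =
      -(σ i j + c * (σ * (epsLo q r * (epsUp q r)ᵀ)).trace *
        (1 : Matrix (Fin 2) (Fin 2) ℂ) i j) := by
    intro c
    have hsplit : ∑ l, ∑ sg, ∑ rh, ∑ ka, ∑ mu, ∑ nu,
        epsUpD q r i l * epsLo q r rh ka * Rm q r c sg ka mu nu *
          epsUp q r mu l * epsUp q r nu j * σ sg rh =
        -((∑ sg, ∑ rh, σ sg rh * ((epsUp q r * epsLo q r) sg i * (epsLo q r * epsUp q r) rh j)) +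
          c * (σ * (epsLo q r * (epsUp q r)ᵀ)).trace *
            ∑ mu, (epsUp q r * epsLo q r) mu i * (epsLo q r * epsUp q r) mu j) := by
      simp only [Rm, epsUpD_eq, Matrix.trace, Matrix.diag, Matrix.mul_apply, Fin.sum_univ_two,
        Matrix.transpose_apply, Matrix.neg_apply]
      simp
      ring
    rw [hsplit, h1, h2]
    simp [Matrix.one_apply, eq_comm]
  rw [sbar, hR]
  simp only [Matrix.smul_apply, Matrix.add_apply, smul_eq_mul]
  ring

open scoped Matrix in
theorem sum_epsD_eq_trace (q r : ℝ) (X τ : Matrix (Fin 2) (Fin 2) ℂ) :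
    ∑ al, ∑ be, ∑ ga, ∑ de, epsLoD q r ga de * X de al * epsUpD q r ga be * τ al be =
      (epsLo q r * (epsUp q r)ᵀ * (X * τ)).trace := by
  simp only [epsUpD_eq, epsLoD_eq, Matrix.trace, Matrix.diag, Matrix.mul_apply, Fin.sum_univ_two,
    Matrix.transpose_apply, Matrix.neg_apply]
  ring

open scoped Matrix in
theorem sum_eps_eq_trace (q r : ℝ) (σ Y : Matrix (Fin 2) (Fin 2) ℂ) :
    ∑ al, ∑ nu, ∑ be, ∑ ga, epsUp q r al nu * σ al be * Y be ga * epsLo q r ga nu =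
      (epsLo q r * (epsUp q r)ᵀ * (σ * Y)).trace := by
  simp only [Matrix.trace, Matrix.diag, Matrix.mul_apply, Fin.sum_univ_two,
    Matrix.transpose_apply]
  ring

theorem sum_epsD_sbar_eq_Gpair {q r : ℝ} (hq : 0 < q) (hr : r ^ 2 < 1) (a : ℝ) (s : Bool)
    (σ τ : Matrix (Fin 2) (Fin 2) ℂ) :
    (1 / (Qval q r : ℂ)) * ∑ al, ∑ be, ∑ ga, ∑ de,
      epsLoD q r ga de * sbar q r a s σ de al * epsUpD q r ga be * τ al be =
      Gpair q r a s σ τ := by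
  rw [Gpair, sum_epsD_eq_trace q r (sbar q r a s σ), sum_eps_eq_trace q r σ (sbar q r a s τ),
    sbar_eq hq hr, sbar_eq hq hr]
  simp only [Matrix.smul_mul, Matrix.mul_smul, Matrix.add_mul, Matrix.mul_add, Matrix.one_mul,
    Matrix.mul_one, Matrix.trace_smul, Matrix.trace_add, smul_eq_mul,
    Matrix.trace_mul_comm σ, Matrix.trace_mul_comm τ]
  ring

/-- The coefficients of `Lor` contracted with the dotted metrics, with a pair of spinor indices. -/
noncomputable def lorCoeff (q r a : ℝ) : Matrix (Fin 4) (Fin 2 × Fin 2) ℂ :=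
  fun L p => (1 / (Qval q r : ℂ)) *
    ∑ ga, ∑ de, epsLoD q r ga de * sbarL q r a L de p.1 * epsUpD q r ga p.2

/-- The quantum Pauli matrices as a square matrix from spinor index pairs to vector indices. -/
noncomputable def pauliMatrix : Matrix (Fin 2 × Fin 2) (Fin 4) ℂ :=
  fun p K => pauli K p.1 p.2

theorem lorCoeff_mul_pauliMatrix {q r : ℝ} (hq : 0 < q) (hr : r ^ 2 < 1) (a : ℝ)
    (hG : IsUnit (GupM q r a true).det) :
    lorCoeff q r a * pauliMatrix = 1 := by
  rw [← Matrix.nonsing_inv_mul _ hG]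
  ext L K
  simp only [Matrix.mul_apply, GupM, ← sum_epsD_sbar_eq_Gpair hq hr]
  simp only [lorCoeff, pauliMatrix, sbarL, GloM, Fintype.sum_prod_type, Fin.sum_univ_two,
    Fin.sum_univ_four]
  ring

theorem pauliMatrix_mul_lorCoeff {q r : ℝ} (hq : 0 < q) (hr : r ^ 2 < 1) (a : ℝ)
    (hG : IsUnit (GupM q r a true).det) :
    pauliMatrix * lorCoeff q r a = 1 :=
  (Matrix.mul_eq_one_comm_of_card_eq _ _ _ (by simp)).mp (lorCoeff_mul_pauliMatrix hq hr a hG)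

theorem lor_eq_sum {A : Type*} [Ring A] [Algebra ℂ A] (q r a : ℝ)
    (M Mb : Fin 2 → Fin 2 → A) (L K : Fin 4) :
    Lor q r a M Mb L K = ∑ p : Fin 2 × Fin 2, ∑ p' : Fin 2 × Fin 2,
      (lorCoeff q r a L p * pauliMatrix p' K) • (M p.1 p'.1 * Mb p.2 p'.2) := by
  simp only [Lor, lorCoeff, pauliMatrix, Fintype.sum_prod_type, Fin.sum_univ_two]
  module

open TensorProduct in
/-- A family of algebra elements whose coproduct is matrix comultiplication stays so after
contracting it with mutually inverse scalar matrices. -/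
theorem sum_smul_comultiplicative {A ι κ : Type*} [Fintype ι] [Fintype κ] [DecidableEq ι]
    [Ring A] [Algebra ℂ A] (Δ : A →ₐ[ℂ] A ⊗[ℂ] A) (N : ι → ι → A)
    (hN : ∀ i j, Δ (N i j) = ∑ k, N i k ⊗ₜ[ℂ] N k j)
    (B : Matrix κ ι ℂ) (S : Matrix ι κ ℂ) (hSB : S * B = 1) (L K : κ) :
    Δ (∑ i, ∑ j, (B L i * S j K) • N i j) =
      ∑ I, (∑ i, ∑ j, (B L i * S j I) • N i j) ⊗ₜ[ℂ] (∑ i, ∑ j, (B I i * S j K) • N i j) := by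
  have hδ (j k : ι) : ∑ I, S j I * B I k = if j = k then 1 else 0 := by
    rw [← Matrix.mul_apply, hSB, Matrix.one_apply]
  calc
    _ = ∑ i, ∑ j, ∑ k, ∑ l, ((B L i * S l K) * if j = k then 1 else 0) •
        (N i j ⊗ₜ[ℂ] N k l) := by
      simp only [map_sum, map_smul, hN, Finset.smul_sum, mul_ite, mul_one, mul_zero, ite_smul,
        zero_smul]
      refine Finset.sum_congr rfl fun i _ => ?_
      rw [Finset.sum_comm]
      refine Finset.sum_congr rfl fun j _ => ?_
      rw [Finset.sum_comm]
      simp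
    _ = ∑ i, ∑ j, ∑ k, ∑ l, ∑ I, ((B L i * S j I) * (B I k * S l K)) •
        (N i j ⊗ₜ[ℂ] N k l) := by
      refine Finset.sum_congr rfl fun i _ => Finset.sum_congr rfl fun j _ =>
        Finset.sum_congr rfl fun k _ => Finset.sum_congr rfl fun l _ => ?_
      rw [← Finset.sum_smul, ← hδ, Finset.mul_sum]
      congr 1
      exact Finset.sum_congr rfl fun I _ => by ring
    _ = _ := by
      simp only [TensorProduct.sum_tmul, TensorProduct.tmul_sum, TensorProduct.smul_tmul_smul]
      simp only [← Finset.sum_product', Finset.univ_product_univ]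
      exact Fintype.sum_equiv
        { toFun := fun x => (x.2.2.2.2, x.2.2.1, x.2.2.2.1, x.1, x.2.1)
          invFun := fun x => (x.2.2.2.1, x.2.2.2.2, x.2.1, x.2.2.1, x.1)
          left_inv := fun _ => rfl
          right_inv := fun _ => rfl } _ _ fun _ => rfl

open TensorProduct in
/-- if `Δ` is a unital algebra homomorphism with
`Δ(M_α^β) = Σ_γ M_α^γ ⊗ M_γ^β` and `Δ(M̄_α̇^β̇) = Σ_γ M̄_α̇^γ̇ ⊗ M̄_γ̇^β̇`, then
`Δ(Λ_L^K) = Σ_I Λ_L^I ⊗ Λ_I^K`. -/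
theorem lorentz_comultiplicative (q r : ℝ) (hq : 0 < q) (hr : r ^ 2 < 1)
    (a : ℝ) (ha : 0 < a) (haQ : a + a⁻¹ = Qval q r)
    (hG : ∀ s, IsUnit (GupM q r a s).det)
    {A : Type*} [Ring A] [Algebra ℂ A] (M Mb : Fin 2 → Fin 2 → A)
    (hu1 : ∀ γ δ : Fin 2,
      ∑ α, ∑ β, epsLo q r α β • (M γ α * M δ β) = epsLo q r γ δ • (1 : A))
    (hu2 : ∀ α β : Fin 2,
      ∑ γ, ∑ δ, epsUp q r γ δ • (M γ α * M δ β) = epsUp q r α β • (1 : A))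
    (hu3 : ∀ γ δ : Fin 2,
      ∑ α, ∑ β, epsLoD q r α β • (Mb γ α * Mb δ β) = epsLoD q r γ δ • (1 : A))
    (hu4 : ∀ α β : Fin 2,
      ∑ γ, ∑ δ, epsUpD q r γ δ • (Mb γ α * Mb δ β) = epsUpD q r α β • (1 : A))
    (hmix : ∀ c : ℂ, (c = (a : ℂ) ∨ c = ((a : ℂ))⁻¹) →
      ∀ α σ ρ β : Fin 2,
        ∑ γ, ∑ δ, Rm q r c β δ ρ γ • (M α γ * Mb σ δ) =
          ∑ γ, ∑ δ, Rm q r c γ σ δ α • (Mb δ ρ * M γ β))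
    (Δ : A →ₐ[ℂ] A ⊗[ℂ] A)
    (hΔM : ∀ α β : Fin 2, Δ (M α β) = ∑ γ, M α γ ⊗ₜ[ℂ] M γ β)
    (hΔMb : ∀ α β : Fin 2, Δ (Mb α β) = ∑ γ, Mb α γ ⊗ₜ[ℂ] Mb γ β) :
    ∀ L K : Fin 4,
      Δ (Lor q r a M Mb L K) = ∑ I, Lor q r a M Mb L I ⊗ₜ[ℂ] Lor q r a M Mb I K := by
  intro L K
  simp only [lor_eq_sum]
  refine sum_smul_comultiplicative Δ (fun p p' => M p.1 p'.1 * Mb p.2 p'.2) (fun p p' => ?_) _ _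
    (pauliMatrix_mul_lorCoeff hq hr a (hG true)) L K
  rw [map_mul, hΔM, hΔMb, Finset.sum_mul_sum, Fintype.sum_prod_type]
  simp only [Algebra.TensorProduct.tmul_mul_tmul]
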